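/- Let Z be a finite type and T a positive natural number. Let r, π : Z → ℝ be strictly positive probability mass functions, and let Q, P : Z → Z → ℝ be strictly positive row-stochastic transition kernels. Define path probability mass functions on Fin (T+1) → Z by q(z) = r (z 0) * ∏_{t=1}^{T} Q (z (t−1)) (z t) and p(z) = π (z 0) * ∏_{t=1}^{T} P (z (t−1)) (z t). Then the Kullback–Leibler divergence between the path distributions decomposes as KL(q‖p) = KL(r‖π) + ∑_{t=1}^{T} ∑_{w : Z} q_{t−1}(w) * KL(Q w ‖ P w), where q_{t−1}(w) = ∑_{z : z (t−1) = w} q(z) is the time-(t−1) marginal of q. -/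

import Mathlib

open scoped Classical

/-- Kullback–Leibler divergence between probability mass functions on a finite type,
with the sum taken over the support of the first argument. -/
noncomputable def KL {Z : Type*} [Fintype Z] (a b : Z → ℝ) : ℝ :=
  ∑ z ∈ Finset.univ.filter fun z => 0 < a z, a z * Real.log (a z / b z)

/-- Weight of a path of a Markov chain with initial law `r` and transition kernel `Q`. -/
def markovPathWeight {Z : Type*} (r : Z → ℝ) (Q : Z → Z → ℝ) {n : ℕ} (z : Fin (n + 1) → Z) : ℝ :=
  r (z 0) * ∏ i : Fin n, Q (z i.castSucc) (z i.succ)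

theorem Fintype.sum_fin_succ_pi_snoc {Z : Type*} [Fintype Z] {n : ℕ} (F : (Fin (n + 1) → Z) → ℝ) :
    ∑ z, F z = ∑ z : Fin n → Z, ∑ v : Z, F (Fin.snoc z v) := by
  rw [← (Fin.snocEquiv fun _ : Fin (n + 1) => Z).sum_comp, Fintype.sum_prod_type_right]
  rfl

theorem markovPathWeight_snoc {Z : Type*} (r : Z → ℝ) (Q : Z → Z → ℝ) {n : ℕ}
    (z : Fin (n + 1) → Z) (v : Z) :
    markovPathWeight r Q (Fin.snoc z v : Fin (n + 2) → Z)
      = markovPathWeight r Q z * Q (z (Fin.last n)) v := by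
  have h0 : (Fin.snoc z v : Fin (n + 2) → Z) 0 = z 0 :=
    Fin.snoc_castSucc (α := fun _ => Z) v z 0
  simp only [markovPathWeight, Fin.prod_univ_castSucc (n := n), Fin.succ_castSucc,
    Fin.snoc_castSucc, Fin.succ_last, Fin.snoc_last, h0, mul_assoc]

theorem sum_markovPathWeight_mul_init {Z : Type*} [Fintype Z] (r : Z → ℝ) {Q : Z → Z → ℝ}
    (hQ1 : ∀ w, ∑ v, Q w v = 1) {n : ℕ} (F : (Fin (n + 1) → Z) → ℝ) :
    ∑ z : Fin (n + 2) → Z, markovPathWeight r Q z * F (fun i => z i.castSucc)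
      = ∑ z, markovPathWeight r Q z * F z := by
  rw [Fintype.sum_fin_succ_pi_snoc]
  refine Finset.sum_congr rfl fun z _ => ?_
  simp only [markovPathWeight_snoc, Fin.snoc_castSucc]
  rw [← Finset.sum_mul, ← Finset.mul_sum, hQ1, mul_one]

theorem sum_markovPathWeight_mul_apply_zero {Z : Type*} [Fintype Z] (r : Z → ℝ) {Q : Z → Z → ℝ}
    (hQ1 : ∀ w, ∑ v, Q w v = 1) (n : ℕ) (f : Z → ℝ) :
    ∑ z : Fin (n + 1) → Z, markovPathWeight r Q z * f (z 0) = ∑ w, r w * f w := by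
  induction n with
  | zero =>
    rw [← (Equiv.funUnique (Fin 1) Z).sum_comp]
    simp [markovPathWeight]
  | succ n ih =>
    rw [← ih]
    exact sum_markovPathWeight_mul_init r hQ1 fun z => f (z 0)

/-- Averaging over one transition, conditionally on its starting state. -/
theorem sum_markovPathWeight_mul_transition {Z : Type*} [Fintype Z] (r : Z → ℝ) {Q : Z → Z → ℝ}
    (hQ1 : ∀ w, ∑ v, Q w v = 1) {n : ℕ} (i : Fin n) (g : Z → Z → ℝ) :
    ∑ z : Fin (n + 1) → Z, markovPathWeight r Q z * g (z i.castSucc) (z i.succ)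
      = ∑ z : Fin (n + 1) → Z, markovPathWeight r Q z *
          ∑ v, Q (z i.castSucc) v * g (z i.castSucc) v := by
  induction n with
  | zero => exact i.elim0
  | succ n ih =>
    induction i using Fin.lastCases with
    | last =>
      rw [sum_markovPathWeight_mul_init r hQ1
        fun z => ∑ v, Q (z (Fin.last n)) v * g (z (Fin.last n)) v, Fintype.sum_fin_succ_pi_snoc]
      simp only [markovPathWeight_snoc, Fin.snoc_castSucc, Fin.succ_last, Fin.snoc_last,
        Finset.mul_sum, mul_assoc]
    | cast i =>
      simp only [Fin.succ_castSucc]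
      rw [sum_markovPathWeight_mul_init r hQ1 fun z => g (z i.castSucc) (z i.succ),
        sum_markovPathWeight_mul_init r hQ1
          fun z => ∑ v, Q (z i.castSucc) v * g (z i.castSucc) v]
      exact ih i

theorem KL_eq_sum {Z : Type*} [Fintype Z] {a : Z → ℝ} (ha : ∀ z, 0 < a z) (b : Z → ℝ) :
    KL a b = ∑ z, a z * Real.log (a z / b z) := by
  simp [KL, ha]

/-- Chain-rule decomposition of the KL divergence between two Markov path
distributions: `KL(q‖p) = KL(r‖π) + ∑_{t=1}^T ∑_w q_{t-1}(w) KL(Q w ‖ P w)`. -/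
theorem kl_markov_path_decomposition
    (Z : Type*) [Fintype Z] (T : ℕ) (hT : 0 < T)
    (r : Z → ℝ) (hr0 : ∀ z, 0 < r z) (hr1 : ∑ z : Z, r z = 1)
    (π : Z → ℝ) (hπ0 : ∀ z, 0 < π z) (hπ1 : ∑ z : Z, π z = 1)
    (Q : Z → Z → ℝ) (hQ0 : ∀ w z, 0 < Q w z) (hQ1 : ∀ w, ∑ z : Z, Q w z = 1)
    (P : Z → Z → ℝ) (hP0 : ∀ w z, 0 < P w z) (hP1 : ∀ w, ∑ z : Z, P w z = 1)
    (q p : (Fin (T + 1) → Z) → ℝ)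
    (hq : ∀ z, q z = r (z 0) * ∏ i : Fin T, Q (z i.castSucc) (z i.succ))
    (hp : ∀ z, p z = π (z 0) * ∏ i : Fin T, P (z i.castSucc) (z i.succ)) :
    KL q p
      = KL r π
        + ∑ i : Fin T, ∑ w : Z,
            (∑ z ∈ Finset.univ.filter fun z : Fin (T + 1) → Z => z i.castSucc = w,
              q z) * KL (Q w) (P w) := by
  obtain rfl : q = markovPathWeight r Q := funext hq
  obtain rfl : p = markovPathWeight π P := funext hp
  have hpos : ∀ z : Fin (T + 1) → Z, 0 < markovPathWeight r Q z := fun z =>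
    mul_pos (hr0 _) (Finset.prod_pos fun _ _ => hQ0 _ _)
  have hlog : ∀ z : Fin (T + 1) → Z,
      Real.log (markovPathWeight r Q z / markovPathWeight π P z)
        = Real.log (r (z 0) / π (z 0))
          + ∑ i : Fin T, Real.log (Q (z i.castSucc) (z i.succ) / P (z i.castSucc) (z i.succ)) := by
    intro z
    have hratio : ∀ w v, Q w v / P w v ≠ 0 := fun w v => (div_pos (hQ0 w v) (hP0 w v)).ne'
    rw [markovPathWeight, markovPathWeight, mul_div_mul_comm, ← Finset.prod_div_distrib,
      Real.log_mul (div_pos (hr0 _) (hπ0 _)).ne' (Finset.prod_ne_zero_iff.2 fun _ _ => hratio _ _),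
      Real.log_prod fun _ _ => hratio _ _]
  rw [KL_eq_sum hpos, KL_eq_sum hr0]
  simp only [hlog, mul_add, Finset.sum_add_distrib, Finset.mul_sum]
  rw [sum_markovPathWeight_mul_apply_zero r hQ1 T fun w => Real.log (r w / π w), Finset.sum_comm]
  congr 1
  refine Finset.sum_congr rfl fun i _ => ?_
  rw [sum_markovPathWeight_mul_transition r hQ1 i fun w v => Real.log (Q w v / P w v),
    ← Finset.sum_fiberwise Finset.univ fun z : Fin (T + 1) → Z => z i.castSucc]
  refine Finset.sum_congr rfl fun w _ => ?_
  rw [Finset.sum_mul]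
  refine Finset.sum_congr rfl fun z hz => ?_
  rw [(Finset.mem_filter.1 hz).2, KL_eq_sum (hQ0 w)]
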